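/- (Quaternionic Busemann–Petty type theorem.) Let A and B be origin-symmetric star bodies in ℍⁿ ≅ ℝ^{4n} (n ≥ 1), and assume A is quaternion-circular, i.e., qz ∈ A for every z ∈ A and every unit quaternion q ∈ S³. If for every unit vector ω ∈ S^{4n-1} one has area₄(A ∩ ℍω) ≤ area₄(B ∩ ℍω), where ℍω = {qω : q ∈ ℍ} is the quaternionic line through ω and area₄ is 4-dimensional Hausdorff measure, then vol(A) ≤ vol(B) for 4n-dimensional Lebesgue measure vol. -/

import Mathlib

open MeasureTheory Metric
open scoped ENNReal

noncomputable instance (n : ℕ) :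
    MeasurableSpace (PiLp 2 fun _ : Fin n => Quaternion ℝ) := borel _
instance (n : ℕ) : BorelSpace (PiLp 2 fun _ : Fin n => Quaternion ℝ) := ⟨rfl⟩

/-- The radial function of a set `D ⊆ ℍⁿ`: `ρ_D(ω) = max {t ≥ 0 | t • ω ∈ D}`. -/
noncomputable def radialFnQ {n : ℕ} (D : Set (PiLp 2 fun _ : Fin n => Quaternion ℝ))
    (ω : PiLp 2 fun _ : Fin n => Quaternion ℝ) : ℝ :=
  sSup {t : ℝ | 0 ≤ t ∧ t • ω ∈ D}

/-- A star body in `ℍⁿ ≅ ℝ^{4n}`: a compact set containing the origin in its interior,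
star-shaped with respect to the origin, whose radial function is continuous on the unit
sphere. -/
def IsStarBodyQ {n : ℕ} (D : Set (PiLp 2 fun _ : Fin n => Quaternion ℝ)) : Prop :=
  IsCompact D ∧ (0 : PiLp 2 fun _ : Fin n => Quaternion ℝ) ∈ interior D ∧
    (∀ x ∈ D, ∀ t : ℝ, 0 ≤ t → t ≤ 1 → t • x ∈ D) ∧
    ContinuousOn (radialFnQ D) (sphere (0 : PiLp 2 fun _ : Fin n => Quaternion ℝ) 1)

/-- `D` is quaternion-circular (`S³`-circular): stable under componentwise scalar
multiplication by unit quaternions. -/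
def IsQuatCircular {n : ℕ} (D : Set (PiLp 2 fun _ : Fin n => Quaternion ℝ)) : Prop :=
  ∀ z ∈ D, ∀ q : Quaternion ℝ, ‖q‖ = 1 → q • z ∈ D

/-- The quaternionic line `ℍω = {qω : q ∈ ℍ}` through `ω`. -/
def quatLine {n : ℕ} (ω : PiLp 2 fun _ : Fin n => Quaternion ℝ) :
    Set (PiLp 2 fun _ : Fin n => Quaternion ℝ) :=
  Set.range fun q : Quaternion ℝ => q • ω

section Polar

open Measure Set

theorem volumeIoiPow_setOf_le (k : ℕ) (x : ℝ) :
    volumeIoiPow k {r : Ioi (0 : ℝ) | r.1 ≤ x} =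
      ENNReal.ofReal x ^ (k + 1) / ((k + 1 : ℕ) : ℝ≥0∞) := by
  rcases le_or_gt x 0 with hx | hx
  · have : {r : Ioi (0 : ℝ) | r.1 ≤ x} = ∅ := by
      ext r
      simpa using hx.trans_lt r.2
    simp [this, ENNReal.ofReal_of_nonpos hx]
  · have hnull : volumeIoiPow k {(⟨x, hx⟩ : Ioi (0 : ℝ))} = 0 := by
      refine withDensity_absolutelyContinuous _ _ ?_
      rw [(MeasurableEmbedding.subtype_coe measurableSet_Ioi).comap_apply]
      simp
    have hset : {r : Ioi (0 : ℝ) | r.1 ≤ x} = Iio ⟨x, hx⟩ ∪ {⟨x, hx⟩} := by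
      rw [Iio_union_right]
      rfl
    have hae : volumeIoiPow k {r : Ioi (0 : ℝ) | r.1 ≤ x} = volumeIoiPow k (Iio ⟨x, hx⟩) := by
      rw [hset]
      exact measure_congr (union_ae_eq_left_of_ae_eq_empty (ae_eq_empty.2 hnull))
    rw [hae, volumeIoiPow_apply_Iio, ENNReal.ofReal_div_of_pos (by positivity),
      ENNReal.ofReal_pow hx.le]
    congr 1
    exact_mod_cast ENNReal.ofReal_natCast (k + 1)

theorem finrank_mul_measure_eq_lintegral_toSphere {E : Type*} [NormedAddCommGroup E]
    [NormedSpace ℝ E] [FiniteDimensional ℝ E] [Nontrivial E] [MeasurableSpace E] [BorelSpace E]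
    (μ : Measure E) [μ.IsAddHaarMeasure] {D : Set E} (hD : MeasurableSet D)
    (ρ : sphere (0 : E) 1 → ℝ)
    (h : ∀ ω : sphere (0 : E) 1, ∀ r : ℝ, 0 < r → (r • (ω : E) ∈ D ↔ r ≤ ρ ω)) :
    (Module.finrank ℝ E : ℝ≥0∞) * μ D =
      ∫⁻ ω, ENNReal.ofReal (ρ ω) ^ Module.finrank ℝ E ∂μ.toSphere := by
  have hd : Module.finrank ℝ E - 1 + 1 = Module.finrank ℝ E :=
    Nat.sub_add_cancel Module.finrank_pos
  have hd0 : (Module.finrank ℝ E : ℝ≥0∞) ≠ 0 := by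
    exact_mod_cast (Module.finrank_pos (R := ℝ) (M := E)).ne'
  have hmp := (μ.measurePreserving_homeomorphUnitSphereProd).symm
    (homeomorphUnitSphereProd E).toMeasurableEquiv
  have hD' : MeasurableSet ((↑) ⁻¹' D : Set ({0}ᶜ : Set E)) := measurable_subtype_coe hD
  have h1 : μ D = μ.comap (↑) ((↑) ⁻¹' D : Set ({0}ᶜ : Set E)) := by
    rw [(MeasurableEmbedding.subtype_coe (measurableSet_singleton _).compl).comap_apply,
      Subtype.image_preimage_coe, inter_comm, ← sdiff_eq, measure_sdiff_null (measure_singleton _)]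
  have h2 : ∀ ω : sphere (0 : E) 1, Prod.mk ω ⁻¹'
      ((homeomorphUnitSphereProd E).toMeasurableEquiv.symm ⁻¹' ((↑) ⁻¹' D)) =
      {r : Ioi (0 : ℝ) | r.1 ≤ ρ ω} := by
    intro ω
    ext r
    exact h ω r.1 r.2
  rw [h1, ← hmp.measure_preimage hD'.nullMeasurableSet,
    Measure.prod_apply (hmp.measurable hD')]
  simp_rw [h2, volumeIoiPow_setOf_le, hd, div_eq_mul_inv]
  rw [lintegral_mul_const' _ _ (by simpa using hd0), mul_comm, mul_assoc,
    ENNReal.inv_mul_cancel hd0 (by simp), mul_one]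

theorem pow_mul_measure_univ_le_lintegral_pow {α : Type*} [MeasurableSpace α] (μ : Measure α)
    [IsFiniteMeasure μ] {f : α → ℝ≥0∞} (hf : AEMeasurable f μ) (a : ℝ≥0∞) {n : ℕ} (hn : 1 ≤ n)
    (h : a * μ univ ≤ ∫⁻ x, f x ∂μ) : a ^ n * μ univ ≤ ∫⁻ x, f x ^ n ∂μ := by
  rcases eq_or_ne μ 0 with rfl | hμ
  · simp
  have : NeZero μ := ⟨hμ⟩
  have h0 : μ univ ≠ 0 := by simpa using hμ
  have ht : μ univ ≠ ∞ := measure_ne_top _ _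
  set ν := (μ univ)⁻¹ • μ with hν
  have : IsProbabilityMeasure ν := isProbabilityMeasureSMul
  have key := eLpNorm'_le_eLpNorm'_of_exponent_le (p := 1) (q := n) one_pos
    (by exact_mod_cast hn) ν (f := f) (hf.smul_measure _).aestronglyMeasurable
  have hnpos : (0 : ℝ) < n := by exact_mod_cast hn
  simp only [eLpNorm', enorm_eq_self, ENNReal.rpow_one, div_one, one_div] at key
  rw [ENNReal.le_rpow_inv_iff hnpos] at key
  simp only [ENNReal.rpow_natCast, hν, lintegral_smul_measure, smul_eq_mul] at key
  rw [← ENNReal.le_div_iff_mul_le (.inl h0) (.inl ht), div_eq_mul_inv, mul_comm] at h ⊢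
  exact (pow_le_pow_left' h n).trans key

end Polar

section StarBody

variable {n : ℕ}

theorem IsStarBodyQ.smul_mem_iff {D : Set (PiLp 2 fun _ : Fin n => Quaternion ℝ)}
    (hD : IsStarBodyQ D) {ω : PiLp 2 fun _ : Fin n => Quaternion ℝ} (hω : ‖ω‖ = 1)
    {r : ℝ} (hr : 0 < r) : r • ω ∈ D ↔ r ≤ radialFnQ D ω := by
  obtain ⟨hcomp, hint, hstar, -⟩ := hD
  have hbdd : BddAbove {t : ℝ | 0 ≤ t ∧ t • ω ∈ D} := by
    obtain ⟨R, hR⟩ := hcomp.isBounded.exists_norm_le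
    refine ⟨R, fun t ht => ?_⟩
    simpa [norm_smul, hω, abs_of_nonneg ht.1] using hR _ ht.2
  have hclosed : IsClosed {t : ℝ | 0 ≤ t ∧ t • ω ∈ D} :=
    isClosed_Ici.inter (hcomp.isClosed.preimage (by fun_prop : Continuous fun t : ℝ => t • ω))
  have hmem := hclosed.csSup_mem ⟨0, le_rfl, by simpa using interior_subset hint⟩ hbdd
  refine ⟨fun h => le_csSup hbdd ⟨hr.le, h⟩, fun h => ?_⟩
  have hpos : 0 < radialFnQ D ω := hr.trans_le h
  have := hstar _ hmem.2 (r / radialFnQ D ω) (by positivity) ((div_le_one hpos).2 h)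
  rwa [smul_smul, show r / radialFnQ D ω * sSup {t : ℝ | 0 ≤ t ∧ t • ω ∈ D} = r from
    div_mul_cancel₀ r hpos.ne'] at this

theorem IsQuatCircular.smul_mem_iff {A : Set (PiLp 2 fun _ : Fin n => Quaternion ℝ)}
    (hA : IsQuatCircular A) {q : Quaternion ℝ} (hq : ‖q‖ = 1)
    (x : PiLp 2 fun _ : Fin n => Quaternion ℝ) : q • x ∈ A ↔ x ∈ A := by
  refine ⟨fun h => ?_, fun h => hA x h q hq⟩
  have hq0 : q ≠ 0 := norm_ne_zero_iff.1 (by simp [hq])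
  simpa [smul_smul, inv_mul_cancel₀ hq0] using hA _ h q⁻¹ (by simp [hq])

theorem inter_quatLine_eq_image (D : Set (PiLp 2 fun _ : Fin n => Quaternion ℝ))
    (ω : PiLp 2 fun _ : Fin n => Quaternion ℝ) :
    D ∩ quatLine ω = (fun q : Quaternion ℝ => q • ω) '' {q | q • ω ∈ D} := by
  rw [quatLine, Set.inter_comm, ← Set.image_univ, ← Set.image_inter_preimage, Set.univ_inter]
  rfl

theorem hausdorffMeasure_inter_quatLine [MeasurableSpace (Quaternion ℝ)]
    [BorelSpace (Quaternion ℝ)] (D : Set (PiLp 2 fun _ : Fin n => Quaternion ℝ))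
    {ω : PiLp 2 fun _ : Fin n => Quaternion ℝ} (hω : ‖ω‖ = 1) :
    μH[4] (D ∩ quatLine ω) = (μH[4] : Measure (Quaternion ℝ)) {q | q • ω ∈ D} := by
  have hiso : Isometry fun q : Quaternion ℝ => q • ω :=
    Isometry.of_dist_eq fun p q => by
      rw [dist_eq_norm, dist_eq_norm, ← sub_smul, norm_smul, hω, mul_one]
  rw [inter_quatLine_eq_image, hiso.hausdorffMeasure_image (.inl (by norm_num))]

theorem volume_setOf_quat_smul_mem {D : Set (PiLp 2 fun _ : Fin n => Quaternion ℝ)}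
    (hD : MeasurableSet D) {q : Quaternion ℝ} (hq : ‖q‖ = 1) :
    volume {x | q • x ∈ D} = volume D := by
  let f : (PiLp 2 fun _ : Fin n => Quaternion ℝ) →ₗᵢ[ℝ] PiLp 2 fun _ : Fin n => Quaternion ℝ :=
    ⟨DistribSMul.toLinearMap ℝ _ q, fun x => by
      rw [DistribSMul.toLinearMap_apply, norm_smul, hq, one_mul]⟩
  exact (f.toLinearIsometryEquiv rfl).measurePreserving.measure_preimage hD.nullMeasurableSet

end StarBody

/-- (Quaternionic Busemann–Petty type theorem.) If `A, B` are
origin-symmetric star bodies in `ℍⁿ ≅ ℝ^{4n}` (`n ≥ 1`), `A` is quaternion-circular, and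
every quaternionic-line cross-section of `A` has 4-dimensional measure at most that of
`B`, then `vol(A) ≤ vol(B)`. -/
theorem volume_le_volume_of_quatArea_le
    (n : ℕ) (hn : 1 ≤ n) (A B : Set (PiLp 2 fun _ : Fin n => Quaternion ℝ))
    (hA : IsStarBodyQ A) (hB : IsStarBodyQ B)
    (hAsymm : A = -A) (hBsymm : B = -B) (hAcirc : IsQuatCircular A)
    (harea : ∀ ω ∈ sphere (0 : PiLp 2 fun _ : Fin n => Quaternion ℝ) 1,
      μH[4] (A ∩ quatLine ω) ≤ μH[4] (B ∩ quatLine ω)) :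
    volume A ≤ volume B := by
  let : MeasurableSpace (Quaternion ℝ) := borel _
  have : BorelSpace (Quaternion ℝ) := ⟨rfl⟩
  have hdimH : Module.finrank ℝ (Quaternion ℝ) = 4 := Quaternion.finrank_eq_four
  have hdim : Module.finrank ℝ (PiLp 2 fun _ : Fin n => Quaternion ℝ) = 4 * n := by
    rw [(WithLp.linearEquiv 2 ℝ (Fin n → Quaternion ℝ)).finrank_eq, Module.finrank_pi_fintype]
    simp [hdimH, mul_comm]
  have : Nontrivial (PiLp 2 fun _ : Fin n => Quaternion ℝ) :=
    Module.nontrivial_of_finrank_pos (R := ℝ) (by omega)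
  have hHaar : (μH[4] : Measure (Quaternion ℝ)).IsAddHaarMeasure := by
    simpa [hdimH] using isAddHaarMeasure_hausdorffMeasure (E := Quaternion ℝ)
  set σ := (μH[4] : Measure (Quaternion ℝ)).toSphere
  set S := (volume : Measure (PiLp 2 fun _ : Fin n => Quaternion ℝ)).toSphere
  have hAm := hA.1.measurableSet
  have hBm := hB.1.measurableSet
  have hnorm : ∀ (u : sphere (0 : Quaternion ℝ) 1)
      (ω : sphere (0 : PiLp 2 fun _ : Fin n => Quaternion ℝ) 1), ‖u.1 • ω.1‖ = 1 := by
    intro u ω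
    rw [norm_smul, norm_eq_of_mem_sphere u, norm_eq_of_mem_sphere ω, one_mul]
  have hcont : Continuous fun p : sphere (0 : PiLp 2 fun _ : Fin n => Quaternion ℝ) 1 ×
      sphere (0 : Quaternion ℝ) 1 => radialFnQ B (p.2.1 • p.1.1) :=
    hB.2.2.2.comp_continuous (by fun_prop) fun p => by simpa using hnorm p.2 p.1
  -- sections by quaternionic lines in polar coordinates
  have hsecA : ∀ ω : sphere (0 : PiLp 2 fun _ : Fin n => Quaternion ℝ) 1,
      4 * μH[4] (A ∩ quatLine ω.1) = ENNReal.ofReal (radialFnQ A ω) ^ 4 * σ Set.univ := by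
    intro ω
    have := finrank_mul_measure_eq_lintegral_toSphere (μH[4] : Measure (Quaternion ℝ))
      (D := {q | q • ω.1 ∈ A})
      ((by fun_prop : Continuous fun q : Quaternion ℝ => q • ω.1).measurable hAm)
      (fun _ => radialFnQ A ω) fun u r hr => by
        rw [Set.mem_ofPred_eq, smul_assoc, smul_comm,
          hAcirc.smul_mem_iff (norm_eq_of_mem_sphere u),
          hA.smul_mem_iff (norm_eq_of_mem_sphere ω) hr]
    rw [hausdorffMeasure_inter_quatLine A (norm_eq_of_mem_sphere ω)]
    simpa only [hdimH, lintegral_const, Nat.cast_ofNat] using this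
  have hsecB : ∀ ω : sphere (0 : PiLp 2 fun _ : Fin n => Quaternion ℝ) 1,
      4 * μH[4] (B ∩ quatLine ω.1) =
        ∫⁻ u, ENNReal.ofReal (radialFnQ B (u.1 • ω.1)) ^ 4 ∂σ := by
    intro ω
    have := finrank_mul_measure_eq_lintegral_toSphere (μH[4] : Measure (Quaternion ℝ))
      (D := {q | q • ω.1 ∈ B})
      ((by fun_prop : Continuous fun q : Quaternion ℝ => q • ω.1).measurable hBm)
      (fun u => radialFnQ B (u.1 • ω.1)) fun u r hr => by
        rw [Set.mem_ofPred_eq, smul_assoc, hB.smul_mem_iff (hnorm u ω) hr]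
    rw [hausdorffMeasure_inter_quatLine B (norm_eq_of_mem_sphere ω)]
    simpa only [hdimH, lintegral_const, Nat.cast_ofNat] using this
  have hjensen : ∀ ω : sphere (0 : PiLp 2 fun _ : Fin n => Quaternion ℝ) 1,
      ENNReal.ofReal (radialFnQ A ω) ^ (4 * n) * σ Set.univ ≤
        ∫⁻ u, ENNReal.ofReal (radialFnQ B (u.1 • ω.1)) ^ (4 * n) ∂σ := by
    intro ω
    simp_rw [pow_mul]
    refine pow_mul_measure_univ_le_lintegral_pow σ ?_ _ hn ?_
    · have : Continuous fun u : sphere (0 : Quaternion ℝ) 1 => radialFnQ B (u.1 • ω.1) :=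
        hB.2.2.2.comp_continuous (by fun_prop) fun u => by
          simpa using hnorm u ω
      exact (this.measurable.ennreal_ofReal.pow_const 4).aemeasurable
    · rw [← hsecA, ← hsecB]
      exact mul_le_mul_right (harea ω ω.2) 4
  -- volumes in polar coordinates
  have hvolA : ((4 * n : ℕ) : ℝ≥0∞) * volume A =
      ∫⁻ ω, ENNReal.ofReal (radialFnQ A ω) ^ (4 * n) ∂S := by
    rw [← hdim]
    exact finrank_mul_measure_eq_lintegral_toSphere volume hAm _ fun ω r hr =>
      hA.smul_mem_iff (norm_eq_of_mem_sphere ω) hr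
  have hvolB : ∀ u : sphere (0 : Quaternion ℝ) 1,
      ∫⁻ ω, ENNReal.ofReal (radialFnQ B (u.1 • ω.1)) ^ (4 * n) ∂S =
        ((4 * n : ℕ) : ℝ≥0∞) * volume B := by
    intro u
    rw [← volume_setOf_quat_smul_mem hBm (norm_eq_of_mem_sphere u), ← hdim]
    refine (finrank_mul_measure_eq_lintegral_toSphere volume
      ((by fun_prop : Continuous fun x : PiLp 2 fun _ : Fin n => Quaternion ℝ =>
        u.1 • x).measurable hBm) (fun ω => radialFnQ B (u.1 • ω.1)) fun ω r hr => ?_).symm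
    rw [Set.mem_preimage, smul_comm, hB.smul_mem_iff (hnorm u ω) hr]
  have hσ0 : σ Set.univ ≠ 0 :=
    Measure.measure_univ_ne_zero.2 (μH[4] : Measure (Quaternion ℝ)).toSphere_ne_zero
  have hσt : σ Set.univ ≠ ∞ := measure_ne_top _ _
  have hle : ((4 * n : ℕ) : ℝ≥0∞) * volume A * σ Set.univ ≤
      ((4 * n : ℕ) : ℝ≥0∞) * volume B * σ Set.univ := by
    calc ((4 * n : ℕ) : ℝ≥0∞) * volume A * σ Set.univ
        = ∫⁻ ω, ENNReal.ofReal (radialFnQ A ω) ^ (4 * n) * σ Set.univ ∂S := by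
          rw [hvolA, lintegral_mul_const' _ _ hσt]
      _ ≤ ∫⁻ ω, ∫⁻ u, ENNReal.ofReal (radialFnQ B (u.1 • ω.1)) ^ (4 * n) ∂σ ∂S :=
          lintegral_mono hjensen
      _ = ∫⁻ u, ∫⁻ ω, ENNReal.ofReal (radialFnQ B (u.1 • ω.1)) ^ (4 * n) ∂S ∂σ :=
          lintegral_lintegral_swap
            (hcont.measurable.ennreal_ofReal.pow_const (4 * n)).aemeasurable
      _ = ((4 * n : ℕ) : ℝ≥0∞) * volume B * σ Set.univ := by
          simp_rw [hvolB, lintegral_const]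
  have hn0 : ((4 * n : ℕ) : ℝ≥0∞) ≠ 0 := by
    exact_mod_cast (by omega : 4 * n ≠ 0)
  rwa [ENNReal.mul_le_mul_iff_left hσ0 hσt,
    ENNReal.mul_le_mul_iff_right hn0 (ENNReal.natCast_ne_top _)] at hle
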